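/- arXiv:1902.06589 — 3 statements merged into one kernel-verified Lean document; each statement's English description precedes it below -/
import Mathlib

section
/- Let K be a field with a nonarchimedean absolute value |·|, let m, r ≥ 1 be integers, let b ∈ K^m with all b_j nonzero, and let x ∈ K^m satisfy |x_j − b_j| ≤ |b_j| for all j. Then for every multi-index k ∈ ℕ^m with |k| ≥ r and every c ∈ K with |c| ≤ |b|_{min,k}^r · |b^k|^{−1}, one has |c · (x−b)^k| ≤ (max_j |x_j − b_j|)^r. -/
/-- If `0 ≤ t j ≤ 1` and `B * t j ≤ D` whenever `k j > 0`, then `B ^ r * ∏ j, t j ^ k j ≤ D ^ r`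
for every `r` not exceeding the total degree `∑ j, k j`. -/
theorem pow_mul_prod_pow_le_pow {ι : Type*} [Fintype ι] {B D : ℝ} (hB : 0 ≤ B) (hD : 0 ≤ D)
    {t : ι → ℝ} (ht0 : ∀ j, 0 ≤ t j) (ht1 : ∀ j, t j ≤ 1) {k : ι → ℕ}
    (hBt : ∀ j, 0 < k j → B * t j ≤ D) {r : ℕ} (hr : r ≤ ∑ j, k j) :
    B ^ r * ∏ j, t j ^ k j ≤ D ^ r := by
  have hnonneg : ∀ j ∈ Finset.univ, 0 ≤ t j ^ k j := fun j _ => pow_nonneg (ht0 j) _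
  rcases le_or_gt B D with hBD | hDB
  · calc B ^ r * ∏ j, t j ^ k j ≤ B ^ r * 1 := by
          gcongr
          exact Finset.prod_le_one hnonneg fun j _ => pow_le_one₀ (ht0 j) (ht1 j)
      _ ≤ D ^ r := by
          rw [mul_one]
          gcongr
  · have hBpos : 0 < B := hD.trans_lt hDB
    have hprod : ∏ j, t j ^ k j ≤ (D / B) ^ ∑ j, k j := by
      rw [← Finset.prod_pow_eq_pow_sum]
      refine Finset.prod_le_prod hnonneg fun j _ => ?_
      rcases Nat.eq_zero_or_pos (k j) with h | h
      · simp [h]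
      · refine pow_le_pow_left₀ (ht0 j) ?_ _
        rw [le_div_iff₀' hBpos]
        exact hBt j h
    calc B ^ r * ∏ j, t j ^ k j ≤ B ^ r * (D / B) ^ r := by
          gcongr
          exact hprod.trans
            (pow_le_pow_of_le_one (by positivity) ((div_le_one hBpos).2 hDB.le) hr)
      _ = D ^ r := by rw [← mul_pow, mul_div_cancel₀ _ hBpos.ne']

/-- Let `K` be a field with a nonarchimedean absolute value, `b ∈ K^m` with
nonzero coordinates and `x ∈ K^m` with `|x_j − b_j| ≤ |b_j|`. Then for every multi-index `k`
with `|k| ≥ r` and every `c` with `|c| ≤ |b|_{min,k}^r · |b^k|^{−1}` one has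
`|c·(x−b)^k| ≤ (max_j |x_j − b_j|)^r`. -/
theorem high_degree_term_bound
    (K : Type) [Field K] (v : AbsoluteValue K ℝ)
    -- `v` is nonarchimedean
    (hna : ∀ x y : K, v (x + y) ≤ max (v x) (v y))
    (m r : ℕ) (hm : 1 ≤ m) (hr : 1 ≤ r)
    (b : Fin m → K) (hb : ∀ j, b j ≠ 0)
    (x : Fin m → K) (hx : ∀ j, v (x j - b j) ≤ v (b j))
    (k : Fin m → ℕ) (hk : r ≤ ∑ j, k j)
    (c : K)
    (hc : v c ≤ (⨅ j : {j : Fin m // 0 < k j}, v (b j.1)) ^ r * (∏ j, v (b j) ^ (k j))⁻¹) :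
    v (c * ∏ j, (x j - b j) ^ (k j)) ≤ (⨆ j, v (x j - b j)) ^ r := by
  have hbpos : ∀ j, 0 < v (b j) := fun j => v.pos (hb j)
  have hB : 0 ≤ ⨅ j : {j : Fin m // 0 < k j}, v (b j.1) :=
    Real.iInf_nonneg fun j => v.nonneg _
  have hD : 0 ≤ ⨆ j, v (x j - b j) := Real.iSup_nonneg fun j => v.nonneg _
  have hBt : ∀ j, 0 < k j →
      (⨅ j : {j : Fin m // 0 < k j}, v (b j.1)) * (v (x j - b j) / v (b j)) ≤
        ⨆ j, v (x j - b j) := fun j hj =>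
    calc _ ≤ v (b j) * (v (x j - b j) / v (b j)) := by
          refine mul_le_mul_of_nonneg_right ?_ (div_nonneg (v.nonneg _) (v.nonneg _))
          exact ciInf_le (Set.finite_range _).bddBelow (⟨j, hj⟩ : {j : Fin m // 0 < k j})
      _ = v (x j - b j) := mul_div_cancel₀ _ (hbpos j).ne'
      _ ≤ _ := le_ciSup (Set.finite_range fun j => v (x j - b j)).bddAbove j
  calc v (c * ∏ j, (x j - b j) ^ k j) = v c * ∏ j, v (x j - b j) ^ k j := by
        simp only [map_mul, map_prod, map_pow]
    _ ≤ (⨅ j : {j : Fin m // 0 < k j}, v (b j.1)) ^ r * (∏ j, v (b j) ^ k j)⁻¹ *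
          ∏ j, v (x j - b j) ^ k j :=
        mul_le_mul_of_nonneg_right hc (Finset.prod_nonneg fun j _ => pow_nonneg (v.nonneg _) _)
    _ = (⨅ j : {j : Fin m // 0 < k j}, v (b j.1)) ^ r *
          ∏ j, (v (x j - b j) / v (b j)) ^ k j := by
        simp only [div_pow, Finset.prod_div_distrib]
        ring
    _ ≤ _ := pow_mul_prod_pow_le_pow hB hD (fun j => div_nonneg (v.nonneg _) (v.nonneg _))
        (fun j => (div_le_one (hbpos j)).2 (hx j)) hBt hk
end

section
/- Let K be a field with a nonarchimedean absolute value |·|, let m, r ≥ 1 be integers, let y ∈ K^m with all y_j nonzero, and let x ∈ K^m. Let k ∈ ℕ^m be a multi-index with 0 < |k| < r and let c ∈ K satisfy |c| ≤ |y|_{min,k}^r · |y^k|^{−1}. If there exists an index i₀ with k_{i₀} > 0 and |y_{i₀}| ≤ |x_{i₀} − y_{i₀}|, then |c · (x−y)^k| ≤ (max_j |x_j − y_j|)^r. -/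
/-- Let `K` be a field with a nonarchimedean absolute value, `y ∈ K^m` with
nonzero coordinates and `x ∈ K^m`. Let `k` be a multi-index with `0 < |k| < r` and `c` with
`|c| ≤ |y|_{min,k}^r · |y^k|^{−1}`. If there is `i₀` with `k_{i₀} > 0` and
`|y_{i₀}| ≤ |x_{i₀} − y_{i₀}|`, then `|c·(x−y)^k| ≤ (max_j |x_j − y_j|)^r`. -/
theorem low_degree_term_bound
    (K : Type) [Field K] (v : AbsoluteValue K ℝ)
    -- `v` is nonarchimedean
    (hna : ∀ x y : K, v (x + y) ≤ max (v x) (v y))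
    (m r : ℕ) (hm : 1 ≤ m) (hr : 1 ≤ r)
    (y : Fin m → K) (hy : ∀ j, y j ≠ 0)
    (x : Fin m → K)
    (k : Fin m → ℕ) (hk0 : 0 < ∑ j, k j) (hkr : ∑ j, k j < r)
    (c : K)
    (hc : v c ≤ (⨅ j : {j : Fin m // 0 < k j}, v (y j.1)) ^ r * (∏ j, v (y j) ^ (k j))⁻¹)
    (i₀ : Fin m) (hi₀ : 0 < k i₀) (hyi : v (y i₀) ≤ v (x i₀ - y i₀)) :
    v (c * ∏ j, (x j - y j) ^ (k j)) ≤ (⨆ j, v (x j - y j)) ^ r := by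
  set n := ⨅ j : {j : Fin m // 0 < k j}, v (y j.1)
  set M := ⨆ j, v (x j - y j)
  have hn_le (j : Fin m) (hj : 0 < k j) : n ≤ v (y j) :=
    ciInf_le (Set.finite_range fun j : {j : Fin m // 0 < k j} ↦ v (y j.1)).bddBelow ⟨j, hj⟩
  have hle_M (j : Fin m) : v (x j - y j) ≤ M :=
    le_ciSup (Set.finite_range fun j ↦ v (x j - y j)).bddAbove j
  have hn : 0 ≤ n := Real.iInf_nonneg fun j ↦ v.nonneg _
  have hnM : n ≤ M := (hn_le i₀ hi₀).trans (hyi.trans (hle_M i₀))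
  have hM : 0 ≤ M := hn.trans hnM
  have hP : 0 < ∏ j, v (y j) ^ k j :=
    Finset.prod_pos fun j _ ↦ pow_pos (v.pos (hy j)) _
  have hnP : n ^ ∑ j, k j ≤ ∏ j, v (y j) ^ k j := by
    rw [← Finset.prod_pow_eq_pow_sum]
    refine Finset.prod_le_prod (fun j _ ↦ pow_nonneg hn _) fun j _ ↦ ?_
    rcases Nat.eq_zero_or_pos (k j) with hj | hj
    · simp [hj]
    · exact pow_le_pow_left₀ hn (hn_le j hj) _
  have hDM : ∏ j, v (x j - y j) ^ k j ≤ M ^ ∑ j, k j := by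
    rw [← Finset.prod_pow_eq_pow_sum]
    exact Finset.prod_le_prod (fun j _ ↦ pow_nonneg (v.nonneg _) _)
      fun j _ ↦ pow_le_pow_left₀ (v.nonneg _) (hle_M j) _
  have hcn : v c ≤ n ^ (r - ∑ j, k j) := by
    refine hc.trans ?_
    rw [← div_eq_mul_inv, div_le_iff₀ hP, ← pow_sub_mul_pow n hkr.le]
    exact mul_le_mul_of_nonneg_left hnP (pow_nonneg hn _)
  calc v (c * ∏ j, (x j - y j) ^ k j)
      = v c * ∏ j, v (x j - y j) ^ k j := by simp [map_prod]
    _ ≤ M ^ (r - ∑ j, k j) * M ^ ∑ j, k j :=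
        mul_le_mul (hcn.trans (pow_le_pow_left₀ hn hnM _)) hDM
          (Finset.prod_nonneg fun j _ ↦ pow_nonneg (v.nonneg _) _) (pow_nonneg hM _)
    _ = M ^ r := pow_sub_mul_pow M hkr.le
end

section
/- Let L be a field with a nonarchimedean absolute value |·| and valuation ring O_L = {x ∈ L : |x| ≤ 1}, and let r ≥ 1 be an integer. Suppose g : U → O_L^k satisfies T_r-approximation, where U ⊆ O_L^m is open, and h : V → O_L^n satisfies T_r-approximation, where V ⊆ O_L^k is open and g(U) ⊆ V. Then the composition h ∘ g : U → O_L^n satisfies T_r-approximation on U. -/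
/-- A function `f : P ⊆ L^m → O_L^n` satisfies `T_r`-approximation (with respect to a
nonarchimedean absolute value `v` on `L`) if `P` is open and for each `y ∈ P` there is an
`n`-tuple of polynomials of total degree `< r`, with coefficients in the valuation ring
`O_L = {x : |x| ≤ 1}`, such that `|f(x) − T(x)| ≤ |x−y|^r` for all `x ∈ P`. -/
def TrApprox {L : Type*} [Field L] (v : L → ℝ) {m n : ℕ} (r : ℕ)
    (P : Set (Fin m → L)) (f : (Fin m → L) → Fin n → L) : Prop :=
  (∀ y ∈ P, ∃ ε : ℝ, 0 < ε ∧ ∀ x : Fin m → L, (∀ j, v (x j - y j) < ε) → x ∈ P) ∧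
  ∀ y ∈ P, ∃ T : Fin n → MvPolynomial (Fin m) L,
    (∀ i, (T i).totalDegree < r) ∧
    (∀ i c, v (MvPolynomial.coeff c (T i)) ≤ 1) ∧
    ∀ x ∈ P, ∀ i, v (f x i - MvPolynomial.eval x (T i)) ≤ (⨆ j, v (x j - y j)) ^ r

open MvPolynomial

/-- Values of a polynomial at congruent points are congruent. -/
theorem MvPolynomial.eval_sub_eval_mem {R σ : Type*} [CommRing R] (I : Ideal R)
    (p : MvPolynomial σ R) {x y : σ → R} (hxy : ∀ j, x j - y j ∈ I) :
    eval x p - eval y p ∈ I := by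
  rw [← Ideal.Quotient.eq, MvPolynomial.map_eval, MvPolynomial.map_eval]
  congr 2
  funext j
  exact Ideal.Quotient.eq.mpr (hxy j)

/-- Taylor truncation: modulo the `r`-th power of the ideal generated by the increments
`x j - y j`, every polynomial agrees with one of total degree less than `r`. -/
theorem MvPolynomial.exists_totalDegree_lt_eval_sub_eval_mem {R σ : Type*} [CommRing R]
    [Nontrivial R] [Fintype σ] (p : MvPolynomial σ R) (y : σ → R) {r : ℕ} (hr : 1 ≤ r) :
    ∃ q : MvPolynomial σ R, q.totalDegree < r ∧
      ∀ x, eval x p - eval x q ∈ Ideal.span (Set.range (x - y)) ^ r := by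
  set p' : MvPolynomial σ R := bind₁ (fun j => X j + C (y j)) p with hp'
  refine ⟨∑ d ∈ p'.support with d.degree < r, C (p'.coeff d) * ∏ j, (X j - C (y j)) ^ d j,
    ?_, fun x => ?_⟩
  · refine Nat.lt_of_le_pred hr (totalDegree_finsetSum_le fun d hd => ?_)
    refine (totalDegree_mul _ _).trans ?_
    rw [totalDegree_C, zero_add]
    refine le_trans ?_ (Nat.le_pred_of_lt (Finset.mem_filter.mp hd).2)
    rw [Finsupp.degree_eq_sum]
    refine (totalDegree_finsetProd _ _).trans (Finset.sum_le_sum fun j _ => ?_)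
    refine (totalDegree_pow _ _).trans ?_
    have hX := totalDegree_sub_C_le (X j) (y j)
    rw [totalDegree_X] at hX
    simpa using Nat.mul_le_mul_left (d j) hX
  · have hp : eval x p = eval (x - y) p' := by
      rw [hp', ← coe_aeval_eq_eval, ← coe_aeval_eq_eval]
      simp only [RingHom.coe_coe]
      rw [aeval_bind₁]
      simp
    rw [hp, eval_eq', ← Finset.sum_filter_add_sum_filter_not _ (fun d => d.degree < r)]
    simp only [map_sum, map_mul, map_prod, map_pow, map_sub, eval_X, eval_C, Pi.sub_apply,
      add_sub_cancel_left]
    refine Ideal.sum_mem _ fun d hd => Ideal.mul_mem_left _ _ ?_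
    refine Ideal.pow_le_pow_right (not_lt.mp (Finset.mem_filter.mp hd).2) ?_
    rw [Finsupp.degree_eq_sum, ← Finset.prod_pow_eq_pow_sum]
    exact Ideal.prod_mem_prod fun j _ =>
      Ideal.pow_mem_pow (Ideal.subset_span (Set.mem_range_self j)) _

namespace AbsoluteValue

variable {L : Type*} [Field L] (v : AbsoluteValue L ℝ)

/-- The valuation ring of a nonarchimedean absolute value. -/
def unitBall (hna : ∀ x y : L, v (x + y) ≤ max (v x) (v y)) : Subring L where
  carrier := {x | v x ≤ 1}
  mul_mem' {a b} ha hb := by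
    rw [Set.mem_ofPred_eq, map_mul]
    exact mul_le_one₀ ha (v.nonneg b) hb
  one_mem' := (map_one v).le
  add_mem' ha hb := (hna _ _).trans (max_le ha hb)
  zero_mem' := by simp
  neg_mem' ha := by simpa using ha

variable {v} {hna : ∀ x y : L, v (x + y) ≤ max (v x) (v y)}

variable (v hna) in
/-- The closed ball of radius `ρ` around `0`, as an ideal of the valuation ring. -/
def ballIdeal {ρ : ℝ} (hρ : 0 ≤ ρ) : Ideal (v.unitBall hna) where
  carrier := {x | v (x : L) ≤ ρ}
  add_mem' ha hb := (hna _ _).trans (max_le ha hb)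
  zero_mem' := by simpa using hρ
  smul_mem' c x hx := by
    change v ((c : L) * x) ≤ ρ
    rw [map_mul]
    exact (mul_le_of_le_one_left (v.nonneg _) c.2).trans hx

theorem ballIdeal_mono {ρ σ : ℝ} (hρ : 0 ≤ ρ) (hσ : 0 ≤ σ) (h : ρ ≤ σ) :
    ballIdeal v hna hρ ≤ ballIdeal v hna hσ :=
  fun _ hx => le_trans hx h

theorem ballIdeal_pow_le {ρ : ℝ} (hρ : 0 ≤ ρ) (r : ℕ) :
    ballIdeal v hna hρ ^ r ≤ ballIdeal v hna (pow_nonneg hρ r) := by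
  induction r with
  | zero =>
    intro x _
    change v (x : L) ≤ ρ ^ 0
    exact x.2.trans (pow_zero ρ).ge
  | succ r ih =>
    rw [pow_succ, Ideal.mul_le]
    intro a ha b hb
    change v ((a : L) * b) ≤ ρ ^ (r + 1)
    rw [map_mul, pow_succ]
    exact mul_le_mul (ih ha) hb (v.nonneg _) (pow_nonneg hρ r)

variable (hna) in
/-- A polynomial with coefficients of absolute value at most one comes from the valuation ring. -/
theorem exists_map_unitBall_eq {σ : Type*} (p : MvPolynomial σ L)
    (hp : ∀ c, v (p.coeff c) ≤ 1) :
    ∃ q : MvPolynomial σ (v.unitBall hna), MvPolynomial.map (v.unitBall hna).subtype q = p := by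
  refine MvPolynomial.mem_range_map_iff_coeffs_subset.mpr fun a ha => ?_
  obtain ⟨c, -, rfl⟩ := MvPolynomial.mem_coeffs_iff.mp ha
  exact ⟨⟨_, hp c⟩, rfl⟩

theorem eval_map_unitBall {σ : Type*} (p : MvPolynomial σ (v.unitBall hna))
    (x : σ → v.unitBall hna) :
    eval (fun j => (x j : L)) (MvPolynomial.map (v.unitBall hna).subtype p) = (eval x p : L) :=
  (MvPolynomial.map_eval (v.unitBall hna).subtype x p).symm

end AbsoluteValue

open AbsoluteValue

/-- Over a field `L` with a nonarchimedean absolute value, if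
`g : U ⊆ O_L^m → O_L^k` and `h : V ⊆ O_L^k → O_L^n` both satisfy `T_r`-approximation and
`g(U) ⊆ V`, then `h ∘ g` satisfies `T_r`-approximation on `U`. -/
theorem TrApprox_comp
    (L : Type) [Field L] (v : AbsoluteValue L ℝ)
    -- `v` is nonarchimedean
    (hna : ∀ x y : L, v (x + y) ≤ max (v x) (v y))
    (r : ℕ) (hr : 1 ≤ r)
    (m k n : ℕ)
    (U : Set (Fin m → L)) (hUO : ∀ x ∈ U, ∀ j, v (x j) ≤ 1)
    (V : Set (Fin k → L)) (hVO : ∀ x ∈ V, ∀ j, v (x j) ≤ 1)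
    (g : (Fin m → L) → Fin k → L) (hgO : ∀ x ∈ U, ∀ i, v (g x i) ≤ 1)
    (h : (Fin k → L) → Fin n → L) (hhO : ∀ x ∈ V, ∀ i, v (h x i) ≤ 1)
    (hg : TrApprox (⇑v) r U g) (hh : TrApprox (⇑v) r V h)
    (hgV : ∀ x ∈ U, g x ∈ V) :
    TrApprox (⇑v) r U (fun x => h (g x)) := by
  refine ⟨hg.1, fun y hy => ?_⟩
  obtain ⟨T, -, hTc, hT⟩ := hg.2 y hy
  obtain ⟨S, -, hSc, hS⟩ := hh.2 (g y) (hgV y hy)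
  choose T' hT' using fun i => exists_map_unitBall_eq hna (T i) (hTc i)
  choose S' hS' using fun i => exists_map_unitBall_eq hna (S i) (hSc i)
  let y' : Fin m → v.unitBall hna := fun j => ⟨y j, hUO y hy j⟩
  choose Q hQdeg hQ using fun i =>
    exists_totalDegree_lt_eval_sub_eval_mem (bind₁ T' (S' i)) y' hr
  refine ⟨fun i => MvPolynomial.map (v.unitBall hna).subtype (Q i), fun i => ?_,
    fun i c => ?_, fun x hx i => ?_⟩
  · exact (Finset.sup_mono (support_map_subset _ _)).trans_lt (hQdeg i)
  · rw [coeff_map]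
    exact (coeff c (Q i)).2
  · let ρ : ℝ := ⨆ j, v (x j - y j)
    have hρ : 0 ≤ ρ := Real.iSup_nonneg fun j => v.nonneg _
    have hle (j) : v (x j - y j) ≤ ρ :=
      le_ciSup (f := fun j => v (x j - y j)) (Set.finite_range _).bddAbove j
    let x' : Fin m → v.unitBall hna := fun j => ⟨x j, hUO x hx j⟩
    have hρ1 : ρ ≤ 1 := Real.iSup_le (fun j => (x' j - y' j).2) zero_le_one
    let gx : Fin k → v.unitBall hna := fun j => ⟨g x j, hgO x hx j⟩
    let gy : Fin k → v.unitBall hna := fun j => ⟨g y j, hgO y hy j⟩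
    let hgx : v.unitBall hna := ⟨h (g x) i, hhO _ (hgV x hx) i⟩
    have hxy (j) : x' j - y' j ∈ ballIdeal v hna hρ := hle j
    have hgT (j) : gx j - eval x' (T' j) ∈ ballIdeal v hna (pow_nonneg hρ r) := by
      have := hT x hx j
      rw [← hT', show x = fun j => (x' j : L) from rfl, eval_map_unitBall] at this
      exact this
    have hgTy (j) : gy j = eval y' (T' j) := by
      have := hT y hy j
      rw [← hT', show y = fun j => (y' j : L) from rfl, eval_map_unitBall] at this
      simp only [sub_self, map_zero, Real.iSup_const_zero,
        zero_pow (Nat.one_le_iff_ne_zero.mp hr)] at this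
      exact Subtype.ext (sub_eq_zero.mp (v.eq_zero.mp (this.antisymm (v.nonneg _))))
    have hlip (j) : gx j - gy j ∈ ballIdeal v hna hρ := by
      rw [← sub_add_sub_cancel _ (eval x' (T' j)), hgTy]
      exact add_mem (ballIdeal_mono _ _ (pow_le_of_le_one hρ hρ1 (by lia)) (hgT j))
        (eval_sub_eval_mem _ _ hxy)
    have hhS : hgx - eval gx (S' i) ∈ ballIdeal v hna (pow_nonneg hρ r) := by
      have := hS (g x) (hgV x hx) i
      rw [← hS', show g x = fun j => (gx j : L) from rfl, eval_map_unitBall] at this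
      exact this.trans (pow_le_pow_left₀ (Real.iSup_nonneg fun j => v.nonneg _)
        (Real.iSup_le hlip hρ) r)
    have hST : eval gx (S' i) - eval x' (bind₁ T' (S' i)) ∈
        ballIdeal v hna (pow_nonneg hρ r) := by
      have : eval x' (bind₁ T' (S' i)) = eval (fun j => eval x' (T' j)) (S' i) := by
        simp only [← aeval_eq_eval, aeval_bind₁]
      rw [this]
      exact eval_sub_eval_mem _ _ hgT
    have hTQ : eval x' (bind₁ T' (S' i)) - eval x' (Q i) ∈
        ballIdeal v hna (pow_nonneg hρ r) := by
      refine ballIdeal_pow_le hρ r (Ideal.pow_right_mono ?_ r (hQ i x'))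
      rw [Ideal.span_le]
      rintro _ ⟨j, rfl⟩
      exact hxy j
    have := add_mem (add_mem hhS hST) hTQ
    rw [sub_add_sub_cancel, sub_add_sub_cancel] at this
    rw [show x = fun j => (x' j : L) from rfl, eval_map_unitBall]
    exact this
end
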